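/- arXiv:1307.2358 — 6 statements merged into one kernel-verified Lean document; each statement's English description precedes it below -/
import Mathlib

section
/- Let Λ be an M×N real matrix of full row rank M (so N ≥ M), let G_F be an N×N real symmetric positive definite matrix, and let B be an M×3 real matrix of full column rank, with M > 3. Then: (i) the matrix G̃ := Λ G_F⁻¹ Λᵀ is symmetric positive definite; (ii) setting L_F := G̃⁻¹ (I − B (Bᵀ G̃⁻¹ B)⁻¹ Bᵀ G̃⁻¹), for every v ∈ ℝ^M the minimum of cᵀ G_F c over all pairs (c, w) ∈ ℝ^N × ℝ³ satisfying Λ c + B w = v equals vᵀ L_F v; (iii) this minimum is attained at the unique minimizing pair given by w = (Bᵀ G̃⁻¹ B)⁻¹ Bᵀ G̃⁻¹ v and c = G_F⁻¹ Λᵀ G̃⁻¹ (v − B w). -/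
open Matrix

/-- Symmetric positive definite quadratic forms satisfy the Pythagorean identity on the constraint
set `Λ c + B w = v`, around any point satisfying the stationarity conditions
`GF c₀ = Λᵀ y`, `Bᵀ y = 0`. -/
theorem dotProduct_mulVec_eq_add_of_stationary {m n k : Type*} [Fintype m] [Fintype n] [Fintype k]
    {Λ : Matrix m n ℝ} {GF : Matrix n n ℝ} {B : Matrix m k ℝ} (hGF : GFᵀ = GF)
    {v y : m → ℝ} {c₀ c : n → ℝ} {w₀ w : k → ℝ}
    (hc₀ : GF.mulVec c₀ = Λᵀ.mulVec y) (hy : Bᵀ.mulVec y = 0)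
    (h₀ : Λ.mulVec c₀ + B.mulVec w₀ = v) (h : Λ.mulVec c + B.mulVec w = v) :
    c ⬝ᵥ GF.mulVec c = v ⬝ᵥ y + (c - c₀) ⬝ᵥ GF.mulVec (c - c₀) := by
  have key : ∀ (c : n → ℝ) (w : k → ℝ), Λ.mulVec c + B.mulVec w = v →
      c ⬝ᵥ GF.mulVec c₀ = v ⬝ᵥ y := by
    intro c w h
    have hB : B.mulVec w ⬝ᵥ y = 0 := by
      rw [dotProduct_comm, dotProduct_mulVec, ← mulVec_transpose, hy, zero_dotProduct]
    rw [hc₀, dotProduct_mulVec, vecMul_transpose, ← h, add_dotProduct, hB, add_zero]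
  have hsymm : c₀ ⬝ᵥ GF.mulVec c = c ⬝ᵥ GF.mulVec c₀ := by
    rw [dotProduct_mulVec, ← mulVec_transpose, hGF, dotProduct_comm]
  simp only [mulVec_sub, dotProduct_sub, sub_dotProduct, hsymm, key c w h, key c₀ w₀ h₀]
  ring

/-- A matrix of full row rank acts injectively on row vectors. -/
theorem vecMul_injective_of_rank_eq_card {m n : Type*} [Fintype m] [Fintype n]
    {Λ : Matrix m n ℝ} (hΛ : Λ.rank = Fintype.card m) : Function.Injective Λ.vecMul := by
  rw [vecMul_injective_iff, linearIndependent_iff_card_eq_finrank_span, ← hΛ,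
    rank_eq_finrank_span_row, Set.finrank]

/-- with `Λ` of full row rank `M` (so `N ≥ M`), `G_F` symmetric positive definite,
and `B` an `M × 3` full-column-rank matrix (`M > 3`): (i) `G̃ := Λ G_F⁻¹ Λᵀ` is symmetric
positive definite; (ii) with `L_F := G̃⁻¹ (I - B (Bᵀ G̃⁻¹ B)⁻¹ Bᵀ G̃⁻¹)`, for every `v`
the minimum of `cᵀ G_F c` over pairs `(c, w)` with `Λ c + B w = v` equals `vᵀ L_F v`;
(iii) attained at the unique pair `w = (Bᵀ G̃⁻¹ B)⁻¹ Bᵀ G̃⁻¹ v`,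
`c = G_F⁻¹ Λᵀ G̃⁻¹ (v - B w)`. -/
theorem stmt2 {M N : ℕ} (hM : 3 < M) (hMN : M ≤ N)
    (Λ : Matrix (Fin M) (Fin N) ℝ) (hΛ : Λ.rank = M)
    (GF : Matrix (Fin N) (Fin N) ℝ) (hGF : GF.PosDef)
    (B : Matrix (Fin M) (Fin 3) ℝ) (hB : Function.Injective B.mulVec) :
    (Λ * GF⁻¹ * Λᵀ).PosDef ∧
    (let Gt : Matrix (Fin M) (Fin M) ℝ := Λ * GF⁻¹ * Λᵀ
     let LF : Matrix (Fin M) (Fin M) ℝ :=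
       Gt⁻¹ * (1 - B * (Bᵀ * Gt⁻¹ * B)⁻¹ * Bᵀ * Gt⁻¹)
     ∀ v : Fin M → ℝ,
       let w₀ : Fin 3 → ℝ := ((Bᵀ * Gt⁻¹ * B)⁻¹ * Bᵀ * Gt⁻¹).mulVec v
       let c₀ : Fin N → ℝ := (GF⁻¹ * Λᵀ * Gt⁻¹).mulVec (v - B.mulVec w₀)
       IsLeast { e : ℝ | ∃ (c : Fin N → ℝ) (w : Fin 3 → ℝ),
           Λ.mulVec c + B.mulVec w = v ∧ e = c ⬝ᵥ GF.mulVec c }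
         (v ⬝ᵥ LF.mulVec v) ∧
       (Λ.mulVec c₀ + B.mulVec w₀ = v ∧ c₀ ⬝ᵥ GF.mulVec c₀ = v ⬝ᵥ LF.mulVec v) ∧
       (∀ (c : Fin N → ℝ) (w : Fin 3 → ℝ), Λ.mulVec c + B.mulVec w = v →
           c ⬝ᵥ GF.mulVec c = v ⬝ᵥ LF.mulVec v → c = c₀ ∧ w = w₀)) := by
  have hGt : (Λ * GF⁻¹ * Λᵀ).PosDef := by
    have := hGF.inv.mul_mul_conjTranspose_same (B := Λ)
      (vecMul_injective_of_rank_eq_card (by simpa using hΛ))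
    rwa [conjTranspose_eq_transpose_of_trivial] at this
  refine ⟨hGt, ?_⟩
  intro Gt LF v w₀ c₀
  have hS : (Bᵀ * Gt⁻¹ * B).PosDef := by
    have := hGt.inv.conjTranspose_mul_mul_same (B := B) hB
    rwa [conjTranspose_eq_transpose_of_trivial] at this
  have hGFdet := (isUnit_iff_isUnit_det _).mp hGF.isUnit
  have hGtdet : IsUnit Gt.det := (isUnit_iff_isUnit_det _).mp hGt.isUnit
  have hSdet := (isUnit_iff_isUnit_det _).mp hS.isUnit
  have hGFsymm : GFᵀ = GF := by
    simpa [conjTranspose_eq_transpose_of_trivial] using hGF.isHermitian.eq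
  have hLF : LF.mulVec v = Gt⁻¹.mulVec (v - B.mulVec w₀) := by
    simp only [LF, w₀, ← mulVec_mulVec, sub_mulVec, one_mulVec]
  have hc₀ : GF.mulVec c₀ = Λᵀ.mulVec (LF.mulVec v) := by
    rw [hLF]
    simp only [c₀, mulVec_mulVec, ← Matrix.mul_assoc, mul_nonsing_inv _ hGFdet, Matrix.one_mul]
  have hy : Bᵀ.mulVec (LF.mulVec v) = 0 := by
    rw [hLF, mulVec_mulVec, mulVec_sub, mulVec_mulVec, sub_eq_zero]
    simp only [w₀, mulVec_mulVec]
    rw [Matrix.mul_assoc _ Bᵀ, mul_nonsing_inv_cancel_left _ _ hSdet]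
  have h₀ : Λ.mulVec c₀ + B.mulVec w₀ = v := by
    have : Λ.mulVec c₀ = v - B.mulVec w₀ := by
      simp only [c₀]
      rw [mulVec_mulVec, ← Matrix.mul_assoc, ← Matrix.mul_assoc, mul_nonsing_inv Gt hGtdet,
        one_mulVec]
    rw [this, sub_add_cancel]
  have hmin {c : Fin N → ℝ} {w : Fin 3 → ℝ} (h : Λ.mulVec c + B.mulVec w = v) :=
    dotProduct_mulVec_eq_add_of_stationary hGFsymm hc₀ hy h₀ h
  have hval : c₀ ⬝ᵥ GF.mulVec c₀ = v ⬝ᵥ LF.mulVec v := by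
    simpa using hmin h₀
  refine ⟨⟨⟨c₀, w₀, h₀, hval.symm⟩, ?_⟩, ⟨h₀, hval⟩, ?_⟩
  · rintro _ ⟨c, w, h, rfl⟩
    have hnonneg := hGF.posSemidef.dotProduct_mulVec_nonneg (c - c₀)
    rw [star_trivial] at hnonneg
    linarith [hmin h]
  · intro c w h heq
    have hc : c = c₀ := by
      by_contra hne
      have hpos := hGF.dotProduct_mulVec_pos (sub_ne_zero.mpr hne)
      rw [star_trivial] at hpos
      linarith [hmin h]
    exact ⟨hc, hB (add_left_cancel (hc ▸ h.trans h₀.symm))⟩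
end

section
/- For every real θ with cos θ ≠ 1, the series Σ_{n=2}^∞ 2 cos(nθ)/(n³ − n) converges and Σ_{n=2}^∞ 2 cos(nθ)/(n³ − n) = (1 − cos θ) · log(2(1 − cos θ)) + (3/2) cos θ − 1. -/
/-- The power series `∑ 2 zⁿ / (n³ - n)`, multiplied by `z`, inside the unit disc. -/
lemma hasSum_two_div_cube_sub_mul_pow {z : ℂ} (hz : ‖z‖ < 1) :
    HasSum (fun n : ℕ => 2 / (((n : ℂ) + 2) ^ 3 - ((n : ℂ) + 2)) * z ^ (n + 3))
      ((1 - z) ^ 2 * -Complex.log (1 - z) + 3 / 2 * z ^ 2 - z) := by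
  have h0 := Complex.hasSum_taylorSeries_neg_log hz
  have h1 := (hasSum_nat_add_iff' 1).2 h0
  have h2 := (hasSum_nat_add_iff' 2).2 h0
  have h3 := (hasSum_nat_add_iff' 3).2 h0
  convert! ((h1.mul_left (z ^ 2)).sub (h2.mul_left (2 * z))).add h3 using 1
  · funext n
    have e1 : (n : ℂ) + 1 ≠ 0 := by exact_mod_cast n.succ_ne_zero
    have e2 : (n : ℂ) + 2 ≠ 0 := by exact_mod_cast (n + 1).succ_ne_zero
    have e3 : (n : ℂ) + 3 ≠ 0 := by exact_mod_cast (n + 2).succ_ne_zero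
    have e : ((n : ℂ) + 2) ^ 3 - ((n : ℂ) + 2) = (n + 1) * (n + 2) * (n + 3) := by ring
    rw [e]
    push_cast
    field_simp
    ring
  · simp [Finset.sum_range_succ]
    ring

lemma summable_two_div_cube_sub :
    Summable (fun n : ℕ => 2 / (((n : ℝ) + 2) ^ 3 - ((n : ℝ) + 2))) := by
  have hs : Summable (fun n : ℕ => 2 * (1 / ((n : ℝ) + 1) ^ 2)) := by
    have := (summable_nat_add_iff 1).2 (Real.summable_one_div_nat_pow.2 one_lt_two)
    exact (by simpa using this : Summable (fun n : ℕ => 1 / ((n : ℝ) + 1) ^ 2)).mul_left 2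
  have hn (n : ℕ) : (0 : ℝ) ≤ n := n.cast_nonneg
  have e (n : ℕ) : ((n : ℝ) + 2) ^ 3 - ((n : ℝ) + 2) = (n + 1) * (n + 2) * (n + 3) := by ring
  refine Summable.of_nonneg_of_le (fun n => ?_) (fun n => ?_) hs
  · rw [e]
    positivity
  · rw [e, mul_one_div]
    gcongr
    nlinarith [hn n, pow_nonneg (hn n) 2, pow_nonneg (hn n) 3]

/-- The closed form persists on the unit circle away from `1`. -/
lemma hasSum_two_div_cube_sub_mul_pow_of_norm_eq_one {w : ℂ} (hw : ‖w‖ = 1) (hre : w.re < 1) :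
    HasSum (fun n : ℕ => 2 / (((n : ℂ) + 2) ^ 3 - ((n : ℂ) + 2)) * w ^ (n + 3))
      ((1 - w) ^ 2 * -Complex.log (1 - w) + 3 / 2 * w ^ 2 - w) := by
  have hnorm (n : ℕ) : ‖2 / (((n : ℂ) + 2) ^ 3 - ((n : ℂ) + 2))‖
      = 2 / (((n : ℝ) + 2) ^ 3 - ((n : ℝ) + 2)) := by
    have e : ((n : ℝ) + 2) ^ 3 - ((n : ℝ) + 2) = (n + 1) * (n + 2) * (n + 3) := by ring
    have h : 2 / (((n : ℂ) + 2) ^ 3 - ((n : ℂ) + 2))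
        = ((2 / (((n : ℝ) + 2) ^ 3 - ((n : ℝ) + 2)) : ℝ) : ℂ) := by push_cast; rfl
    rw [h, Complex.norm_of_nonneg]
    rw [e]
    positivity
  have hle {z : ℂ} (hz : ‖z‖ ≤ 1) (n : ℕ) :
      ‖2 / (((n : ℂ) + 2) ^ 3 - ((n : ℂ) + 2)) * z ^ (n + 3)‖
        ≤ 2 / (((n : ℝ) + 2) ^ 3 - ((n : ℝ) + 2)) := by
    rw [norm_mul, norm_pow, ← hnorm]
    exact mul_le_of_le_one_right (norm_nonneg _) (pow_le_one₀ (norm_nonneg _) hz)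
  have hcont : ContinuousOn
      (fun z : ℂ => ∑' n : ℕ, 2 / (((n : ℂ) + 2) ^ 3 - ((n : ℂ) + 2)) * z ^ (n + 3))
      (Metric.closedBall 0 1) :=
    continuousOn_tsum (fun n => by fun_prop) summable_two_div_cube_sub
      fun n z hz => hle (mem_closedBall_zero_iff.1 hz) n
  have hball : Metric.ball (0 : ℂ) 1 ⊆ Metric.closedBall 0 1 := Metric.ball_subset_closedBall
  have hmem : w ∈ Metric.closedBall (0 : ℂ) 1 := mem_closedBall_zero_iff.2 hw.le
  have hclos : w ∈ closure (Metric.ball (0 : ℂ) 1) := by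
    rwa [closure_ball _ one_ne_zero]
  have : (nhdsWithin w (Metric.ball (0 : ℂ) 1)).NeBot := mem_closure_iff_nhdsWithin_neBot.1 hclos
  have hslit : 1 - w ∈ Complex.slitPlane := Or.inl (by simpa using hre)
  have hform : ContinuousAt
      (fun z : ℂ => (1 - z) ^ 2 * -Complex.log (1 - z) + 3 / 2 * z ^ 2 - z) w := by
    have : ContinuousAt (fun z : ℂ => Complex.log (1 - z)) w :=
      ContinuousAt.clog (by fun_prop) hslit
    fun_prop
  have heq : ∑' n : ℕ, 2 / (((n : ℂ) + 2) ^ 3 - ((n : ℂ) + 2)) * w ^ (n + 3)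
      = (1 - w) ^ 2 * -Complex.log (1 - w) + 3 / 2 * w ^ 2 - w := by
    refine tendsto_nhds_unique ((hcont w hmem).mono hball)
      ((hform.mono_left nhdsWithin_le_nhds).congr' ?_)
    filter_upwards [self_mem_nhdsWithin] with z hz
    exact (hasSum_two_div_cube_sub_mul_pow (mem_ball_zero_iff.1 hz)).tsum_eq.symm
  rw [← heq]
  exact (Summable.of_norm_bounded summable_two_div_cube_sub (hle hw.le)).hasSum

/-- for real `θ` with `cos θ ≠ 1`, the series `Σ_{n=2}^∞ 2 cos(nθ)/(n³ - n)`
converges to `(1 - cos θ) log(2(1 - cos θ)) + (3/2) cos θ - 1`. -/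
theorem stmt5 (θ : ℝ) (h : Real.cos θ ≠ 1) :
    HasSum
      (fun n : ℕ => 2 * Real.cos (((n : ℝ) + 2) * θ) / (((n : ℝ) + 2) ^ 3 - ((n : ℝ) + 2)))
      ((1 - Real.cos θ) * Real.log (2 * (1 - Real.cos θ)) + (3 / 2) * Real.cos θ - 1) := by
  set w : ℂ := Complex.exp (θ * Complex.I) with hwdef
  have hw : ‖w‖ = 1 := Complex.norm_exp_ofReal_mul_I θ
  have hre : w.re = Real.cos θ := Complex.exp_ofReal_mul_I_re θ
  have him : w.im = Real.sin θ := Complex.exp_ofReal_mul_I_im θ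
  have hw0 : w ≠ 0 := Complex.exp_ne_zero _
  have hlog : (Complex.log (1 - w)).re = Real.log (2 * (1 - Real.cos θ)) / 2 := by
    have hsq : ‖1 - w‖ ^ 2 = 2 * (1 - Real.cos θ) := by
      rw [← Complex.normSq_eq_norm_sq, Complex.normSq_apply]
      simp only [Complex.sub_re, Complex.sub_im, Complex.one_re, Complex.one_im, hre, him]
      linear_combination Real.sin_sq_add_cos_sq θ
    rw [Complex.log_re, ← hsq, Real.log_pow]
    push_cast
    ring
  have hinv : w⁻¹ = 2 * (Real.cos θ : ℂ) - w := by
    rw [hwdef, ← Complex.exp_neg, Complex.ofReal_cos, Complex.two_cos]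
    ring_nf
  have hsum := Complex.hasSum_re ((hasSum_two_div_cube_sub_mul_pow_of_norm_eq_one hw
    (hre ▸ lt_of_le_of_ne (Real.cos_le_one θ) h)).mul_left w⁻¹)
  convert! hsum using 1
  · funext n
    have hpow : w ^ (n + 2) = Complex.exp (((((n : ℝ) + 2) * θ : ℝ) : ℂ) * Complex.I) := by
      rw [hwdef, ← Complex.exp_nat_mul]
      push_cast
      ring_nf
    have hterm : w⁻¹ * (2 / (((n : ℂ) + 2) ^ 3 - ((n : ℂ) + 2)) * w ^ (n + 3))
        = ((2 / (((n : ℝ) + 2) ^ 3 - ((n : ℝ) + 2)) : ℝ) : ℂ) * w ^ (n + 2) := by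
      rw [pow_succ w (n + 2)]
      push_cast
      field_simp
    rw [hterm, Complex.re_ofReal_mul, hpow, Complex.exp_ofReal_mul_I_re]
    ring
  · have hmul : w⁻¹ * w = 1 := inv_mul_cancel₀ hw0
    have hclosed : w⁻¹ * ((1 - w) ^ 2 * -Complex.log (1 - w) + 3 / 2 * w ^ 2 - w)
        = ((2 * (1 - Real.cos θ) : ℝ) : ℂ) * Complex.log (1 - w)
          + ((3 / 2 : ℝ) : ℂ) * w - 1 := by
      push_cast [-Complex.ofReal_cos]
      linear_combination (-Complex.log (1 - w)) * hinv
        + (Complex.log (1 - w) * (2 - w) + 3 / 2 * w - 1) * hmul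
    rw [hclosed, Complex.sub_re, Complex.add_re, Complex.re_ofReal_mul, Complex.re_ofReal_mul,
      hlog, hre, Complex.one_re]
    ring
end

section
/- Define G : ℝ → ℝ by G(θ) = Σ_{n=2}^∞ 2 cos(nθ)/(n³ − n) (this series converges absolutely for every θ). Let q₁, …, q_M ∈ [0, 2π) be pairwise distinct real numbers. Then the M×M matrix K with entries K_{ij} = G(q_i − q_j) is symmetric and positive definite: for every nonzero c ∈ ℝ^M one has Σ_{i,j} c_i c_j G(q_i − q_j) > 0. -/
open Matrix

/-- The Green's function `G(θ) = Σ_{n=2}^∞ 2 cos(nθ)/(n³ - n)` of the Weil–Petersson metric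
operator on the circle. -/
noncomputable def wpGreen (θ : ℝ) : ℝ :=
  ∑' n : ℕ, 2 * Real.cos (((n : ℝ) + 2) * θ) / (((n : ℝ) + 2) ^ 3 - ((n : ℝ) + 2))

/-- The defining series of `wpGreen` converges. -/
theorem hasSum_wpGreen (θ : ℝ) :
    HasSum (fun n : ℕ => 2 * Real.cos (((n : ℝ) + 2) * θ) / (((n : ℝ) + 2) ^ 3 - ((n : ℝ) + 2)))
      (wpGreen θ) := by
  refine Summable.hasSum ?_
  have hs : Summable fun n : ℕ => 2 * (1 / ((n : ℝ) + 1) ^ 2) := by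
    have h := (summable_nat_add_iff 1).2 (Real.summable_one_div_nat_pow.2 one_lt_two)
    simpa using h.mul_left 2
  refine hs.of_norm_bounded fun n => ?_
  have hn : (0 : ℝ) ≤ n := n.cast_nonneg
  have hd : ((n : ℝ) + 1) ^ 2 ≤ ((n : ℝ) + 2) ^ 3 - ((n : ℝ) + 2) := by
    nlinarith [pow_nonneg hn 2, pow_nonneg hn 3]
  have hp : (0 : ℝ) < ((n : ℝ) + 1) ^ 2 := by positivity
  rw [norm_div, norm_mul, Real.norm_eq_abs, Real.norm_eq_abs, Real.norm_eq_abs,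
    abs_of_pos (hp.trans_le hd), abs_two, mul_one_div]
  gcongr
  linarith [Real.abs_cos_le_one (((n : ℝ) + 2) * θ)]

theorem wpGreen_neg (θ : ℝ) : wpGreen (-θ) = wpGreen θ := by
  simp [wpGreen]

theorem sum_mul_mul_cos_sub {ι : Type*} [Fintype ι] (c x : ι → ℝ) :
    ∑ i, ∑ j, c i * c j * Real.cos (x i - x j) =
      (∑ i, c i * Real.cos (x i)) ^ 2 + (∑ i, c i * Real.sin (x i)) ^ 2 := by
  rw [sq, sq, Finset.sum_mul_sum, Finset.sum_mul_sum, ← Finset.sum_add_distrib]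
  refine Finset.sum_congr rfl fun i _ => ?_
  rw [← Finset.sum_add_distrib]
  refine Finset.sum_congr rfl fun j _ => ?_
  rw [Real.cos_sub]
  ring

/-- The quadratic form of `wpGreen` as a sum of squares over the Fourier modes. -/
theorem hasSum_sum_mul_mul_wpGreen {ι : Type*} [Fintype ι] (c q : ι → ℝ) :
    HasSum (fun n : ℕ => 2 / (((n : ℝ) + 2) ^ 3 - ((n : ℝ) + 2)) *
        ((∑ i, c i * Real.cos (((n : ℝ) + 2) * q i)) ^ 2 +
          (∑ i, c i * Real.sin (((n : ℝ) + 2) * q i)) ^ 2))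
      (∑ i, ∑ j, c i * c j * wpGreen (q i - q j)) := by
  have h : HasSum _ (∑ i, ∑ j, c i * c j * wpGreen (q i - q j)) :=
    hasSum_sum fun i _ => hasSum_sum fun j _ => (hasSum_wpGreen (q i - q j)).mul_left (c i * c j)
  convert h using 2 with n
  rw [← sum_mul_mul_cos_sub, Finset.mul_sum]
  refine Finset.sum_congr rfl fun i _ => ?_
  rw [Finset.mul_sum]
  refine Finset.sum_congr rfl fun j _ => ?_
  rw [mul_sub]
  ring

/-- Coefficients at distinct points of the circle vanish if all their Fourier modes of order at
least two do. -/
theorem eq_zero_of_forall_sum_mul_cos_sin_eq_zero {M : ℕ} {q : Fin M → ℝ}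
    (hq : ∀ i, q i ∈ Set.Ico 0 (2 * Real.pi)) (hq' : Function.Injective q) {c : Fin M → ℝ}
    (hcos : ∀ n : ℕ, ∑ i, c i * Real.cos (((n : ℝ) + 2) * q i) = 0)
    (hsin : ∀ n : ℕ, ∑ i, c i * Real.sin (((n : ℝ) + 2) * q i) = 0) : c = 0 := by
  have hz : Function.Injective fun i => Complex.exp (q i * Complex.I) := fun i j hij =>
    hq' (Circle.exp_injOn_Ico (by simp) (hq i) (hq j) (Circle.ext (by simpa using hij)))
  have hv := Matrix.eq_zero_of_forall_pow_sum_mul_pow_eq_zero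
    (v := fun i => (c i : ℂ) * Complex.exp (q i * Complex.I) ^ 2) hz fun n => by
      have hterm : ∀ i, (c i : ℂ) * Complex.exp (q i * Complex.I) ^ 2 *
          Complex.exp (q i * Complex.I) ^ (n : ℕ) =
          ((c i * Real.cos ((((n : ℕ) : ℝ) + 2) * q i) : ℝ) : ℂ) +
            ((c i * Real.sin ((((n : ℕ) : ℝ) + 2) * q i) : ℝ) : ℂ) * Complex.I := fun i => by
        rw [mul_assoc, ← pow_add, ← Complex.exp_nat_mul, ← mul_assoc, Complex.exp_mul_I]
        push_cast
        rw [add_comm (2 : ℂ)]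
        ring
      simp_rw [hterm]
      rw [Finset.sum_add_distrib, ← Finset.sum_mul, ← Complex.ofReal_sum, ← Complex.ofReal_sum,
        hcos, hsin]
      simp
  funext i
  simpa using congrFun hv i

theorem sum_mul_mul_wpGreen_pos {M : ℕ} {q : Fin M → ℝ}
    (hq : ∀ i, q i ∈ Set.Ico 0 (2 * Real.pi)) (hq' : Function.Injective q) {c : Fin M → ℝ}
    (hc : c ≠ 0) : 0 < ∑ i, ∑ j, c i * c j * wpGreen (q i - q j) := by
  have hw : ∀ n : ℕ, (0 : ℝ) < 2 / (((n : ℝ) + 2) ^ 3 - ((n : ℝ) + 2)) := fun n => by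
    have hn : (0 : ℝ) ≤ n := n.cast_nonneg
    have hd : (0 : ℝ) < ((n : ℝ) + 2) ^ 3 - ((n : ℝ) + 2) := by
      nlinarith [pow_nonneg hn 2, pow_nonneg hn 3]
    positivity
  have hs := hasSum_sum_mul_mul_wpGreen c q
  have hnonneg := fun n : ℕ => mul_nonneg (hw n).le
    (add_nonneg (sq_nonneg (∑ i, c i * Real.cos (((n : ℝ) + 2) * q i)))
      (sq_nonneg (∑ i, c i * Real.sin (((n : ℝ) + 2) * q i))))
  refine (hs.nonneg hnonneg).lt_of_ne' fun h0 => hc ?_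
  rw [h0, hasSum_zero_iff_of_nonneg hnonneg] at hs
  have hsq := fun n : ℕ => (add_eq_zero_iff_of_nonneg (sq_nonneg _) (sq_nonneg _)).1
    ((mul_eq_zero.1 (congrFun hs n)).resolve_left (hw n).ne')
  exact eq_zero_of_forall_sum_mul_cos_sin_eq_zero hq hq'
    (fun n => pow_eq_zero_iff two_ne_zero |>.1 (hsq n).1)
    (fun n => pow_eq_zero_iff two_ne_zero |>.1 (hsq n).2)

/-- for pairwise distinct `q₁, …, q_M ∈ [0, 2π)`, the matrix
`K_{ij} = G(q_i - q_j)` is symmetric positive definite; in particular the quadratic form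
`Σ_{i,j} c_i c_j G(q_i - q_j)` is strictly positive for every nonzero `c`. -/
theorem stmt6 {M : ℕ} (q : Fin M → ℝ)
    (hq : ∀ i, q i ∈ Set.Ico 0 (2 * Real.pi)) (hq' : Function.Injective q) :
    (Matrix.of fun i j => wpGreen (q i - q j)).PosDef ∧
    ∀ c : Fin M → ℝ, c ≠ 0 → 0 < ∑ i, ∑ j, c i * c j * wpGreen (q i - q j) := by
  refine ⟨.of_dotProduct_mulVec_pos ?_ fun c hc => ?_, fun c => sum_mul_mul_wpGreen_pos hq hq'⟩
  · refine Matrix.IsHermitian.ext fun i j => ?_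
    rw [Matrix.of_apply, Matrix.of_apply, star_trivial, ← neg_sub, wpGreen_neg]
  · refine (sum_mul_mul_wpGreen_pos hq hq' hc).trans_eq ?_
    simp only [dotProduct, mulVec, Finset.mul_sum, Matrix.of_apply, Pi.star_apply, star_trivial]
    refine Finset.sum_congr rfl fun i _ => Finset.sum_congr rfl fun j _ => ?_
    ring
end

section
/- Let A be an m×n real matrix and R a k×n real matrix with ker A ∩ ker R = {0}, and let b ∈ ℝ^m lie in the range of A. Then there exists exactly one x ∈ ℝ^n minimizing ‖R x‖₂ subject to the constraint A x = b; that is, the weighted minimum-norm solution of the consistent linear system A x = b is unique. -/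
open Matrix

/-- The Euclidean (`ℓ²`) norm of a vector in `ℝ^k`. -/
noncomputable def euclNorm {k : ℕ} (x : Fin k → ℝ) : ℝ :=
  Real.sqrt (x ⬝ᵥ x)

/-- Least squares over a subspace `S`: some residual `u - R z` with `z ∈ S` is orthogonal
to `R w` for every `w ∈ S`. -/
theorem exists_mem_forall_dotProduct_mulVec_eq_zero {n k : ℕ}
    (R : Matrix (Fin k) (Fin n) ℝ) (S : Submodule ℝ (Fin n → ℝ)) (u : Fin k → ℝ) :
    ∃ z ∈ S, ∀ w ∈ S, (u - R *ᵥ z) ⬝ᵥ R *ᵥ w = 0 := by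
  let f : (Fin n → ℝ) →ₗ[ℝ] EuclideanSpace ℝ (Fin k) :=
    (WithLp.linearEquiv 2 ℝ (Fin k → ℝ)).symm.toLinearMap ∘ₗ R.mulVecLin
  have hf : ∀ w, f w = WithLp.toLp 2 (R *ᵥ w) := fun _ => rfl
  obtain ⟨z, hz, hfz⟩ : (S.map f).starProjection (WithLp.toLp 2 u) ∈ S.map f :=
    Submodule.starProjection_apply_mem _ _
  refine ⟨z, hz, fun w hw => ?_⟩
  have h := Submodule.starProjection_inner_eq_zero (K := S.map f) (WithLp.toLp 2 u) (f w)
    (Submodule.mem_map_of_mem hw)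
  rw [← hfz, hf, hf, ← WithLp.toLp_sub, EuclideanSpace.inner_toLp_toLp] at h
  rw [dotProduct_comm]
  simpa using h

/-- if `ker A ∩ ker R = {0}` and `b` is in the range of `A`, then there is exactly
one `x` minimizing `‖R x‖₂` subject to `A x = b`. -/
theorem stmt9 {m n k : ℕ}
    (A : Matrix (Fin m) (Fin n) ℝ) (R : Matrix (Fin k) (Fin n) ℝ)
    (hker : ∀ x : Fin n → ℝ, A.mulVec x = 0 → R.mulVec x = 0 → x = 0)
    (b : Fin m → ℝ) (hb : b ∈ Set.range A.mulVec) :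
    ∃! x : Fin n → ℝ, A.mulVec x = b ∧
      ∀ y : Fin n → ℝ, A.mulVec y = b → euclNorm (R.mulVec x) ≤ euclNorm (R.mulVec y) := by
  obtain ⟨x₀, hx₀⟩ := hb
  obtain ⟨z, hz, horth⟩ := exists_mem_forall_dotProduct_mulVec_eq_zero R
    (LinearMap.ker A.mulVecLin) (R *ᵥ x₀)
  have hAz : A *ᵥ z = 0 := by simpa using hz
  have hx : A *ᵥ (x₀ - z) = b := by rw [mulVec_sub, hAz, sub_zero]; exact hx₀
  rw [← mulVec_sub] at horth
  generalize x₀ - z = x at hx horth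
  have hpyth : ∀ y, A *ᵥ y = b →
      R *ᵥ y ⬝ᵥ R *ᵥ y = R *ᵥ x ⬝ᵥ R *ᵥ x + R *ᵥ (y - x) ⬝ᵥ R *ᵥ (y - x) := by
    intro y hy
    have h := horth (y - x) (by simp [mulVec_sub, hx, hy])
    have hRy : R *ᵥ y = R *ᵥ x + R *ᵥ (y - x) := by rw [← mulVec_add, add_sub_cancel]
    rw [hRy, add_dotProduct, dotProduct_add, dotProduct_add,
      dotProduct_comm (R *ᵥ (y - x)) (R *ᵥ x), h]
    ring
  have hnonneg : ∀ v : Fin k → ℝ, 0 ≤ v ⬝ᵥ v := fun v =>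
    Finset.sum_nonneg fun i _ => mul_self_nonneg (v i)
  refine ⟨x, ⟨hx, fun y hy => Real.sqrt_le_sqrt ?_⟩, ?_⟩
  · rw [hpyth y hy]
    exact le_add_of_nonneg_right (hnonneg _)
  · rintro y ⟨hy, hmin⟩
    have hle := (Real.sqrt_le_sqrt_iff (hnonneg _)).mp (hmin x hx)
    have hzero : R *ᵥ (y - x) ⬝ᵥ R *ᵥ (y - x) = 0 :=
      le_antisymm (by linarith [hpyth y hy]) (hnonneg _)
    exact sub_eq_zero.mp
      (hker _ (by rw [mulVec_sub, hx, hy, sub_self]) (dotProduct_self_eq_zero.mp hzero))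
end

section
/- Let A be an m×n real matrix and R a k×n real matrix admitting a generalized singular value decomposition A = U C X⁻¹, R = V S X⁻¹, where U is an m×m orthogonal matrix, V is a k×k orthogonal matrix, X is an invertible n×n matrix, C is an m×n matrix and S is a k×n matrix whose off-diagonal entries vanish (C_{ij} = 0 and S_{ij} = 0 for i ≠ j), whose diagonal entries are nonnegative, and which satisfy Cᵀ C + Sᵀ S = I_n. Define the n×m matrix C† by (C†)_{ii} = 1/C_{ii} whenever C_{ii} ≠ 0, with all other entries zero. Then for every v ∈ ℝ^m in the range of A, the vector x₀ := X C† Uᵀ v satisfies A x₀ = v, and ‖R x₀‖₂ ≤ ‖R x‖₂ for every x ∈ ℝ^n with A x = v; moreover x₀ is the unique such minimizer. -/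
open Matrix

theorem Matrix.mulVec_apply_of_rectDiagonal {m n : ℕ} {M : Matrix (Fin m) (Fin n) ℝ}
    (hM : ∀ (i : Fin m) (j : Fin n), (i : ℕ) ≠ (j : ℕ) → M i j = 0) (x : Fin n → ℝ)
    {i : Fin m} {j : Fin n} (hij : (i : ℕ) = (j : ℕ)) : (M *ᵥ x) i = M i j * x j := by
  refine Finset.sum_eq_single j (fun l _ hl => ?_) (fun h => absurd (Finset.mem_univ j) h)
  exact mul_eq_zero_of_left (hM i l fun h => hl (Fin.ext (h.symm.trans hij))) _

/-- The Moore–Penrose pseudoinverse of a rectangular diagonal matrix. -/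
noncomputable def Matrix.rectDiagonalPinv {m n : ℕ} (C : Matrix (Fin m) (Fin n) ℝ) :
    Matrix (Fin n) (Fin m) ℝ :=
  Matrix.of fun i j => if (i : ℕ) = (j : ℕ) ∧ C j i ≠ 0 then (C j i)⁻¹ else 0

theorem Matrix.mulVec_rectDiagonalPinv_mulVec_mulVec {m n : ℕ} {C : Matrix (Fin m) (Fin n) ℝ}
    (hC : ∀ (i : Fin m) (j : Fin n), (i : ℕ) ≠ (j : ℕ) → C i j = 0) (z : Fin n → ℝ) :
    C *ᵥ (C.rectDiagonalPinv *ᵥ (C *ᵥ z)) = C *ᵥ z := by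
  have hD : ∀ (i : Fin n) (j : Fin m), (i : ℕ) ≠ (j : ℕ) → C.rectDiagonalPinv i j = 0 :=
    fun i j h => by simp [rectDiagonalPinv, h]
  ext i
  by_cases hi : (i : ℕ) < n
  · have hij : (i : ℕ) = ((⟨i, hi⟩ : Fin n) : ℕ) := rfl
    rw [mulVec_apply_of_rectDiagonal hC _ hij, mulVec_apply_of_rectDiagonal hD _ hij.symm,
      mulVec_apply_of_rectDiagonal hC _ hij]
    by_cases h : C i ⟨i, hi⟩ = 0
    · simp [h]
    · simp [rectDiagonalPinv, h]
  · have h0 : ∀ y : Fin n → ℝ, (C *ᵥ y) i = 0 := fun y => by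
      rw [mulVec, dotProduct]
      exact Finset.sum_eq_zero fun l _ => mul_eq_zero_of_left (hC i l (by lia)) _
    rw [h0, h0]

theorem Matrix.rectDiagonalPinv_mulVec_dotProduct_eq_zero {m n : ℕ}
    {C : Matrix (Fin m) (Fin n) ℝ}
    (hC : ∀ (i : Fin m) (j : Fin n), (i : ℕ) ≠ (j : ℕ) → C i j = 0) (u : Fin m → ℝ)
    {w : Fin n → ℝ} (hw : C *ᵥ w = 0) : (C.rectDiagonalPinv *ᵥ u) ⬝ᵥ w = 0 := by
  refine Finset.sum_eq_zero fun i _ => ?_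
  rw [mulVec, dotProduct, Finset.sum_mul]
  refine Finset.sum_eq_zero fun j _ => ?_
  by_cases h : (i : ℕ) = (j : ℕ) ∧ C j i ≠ 0
  · have hji := congrFun hw j
    rw [mulVec_apply_of_rectDiagonal hC w h.1.symm] at hji
    rw [(mul_eq_zero.mp hji).resolve_left h.2, mul_zero]
  · simp [rectDiagonalPinv, h]

theorem Matrix.mulVec_dotProduct_mulVec {m n : ℕ} (M : Matrix (Fin m) (Fin n) ℝ)
    (x y : Fin n → ℝ) : (M *ᵥ x) ⬝ᵥ (M *ᵥ y) = x ⬝ᵥ ((Mᵀ * M) *ᵥ y) := by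
  rw [← mulVec_mulVec, dotProduct_mulVec x, vecMul_transpose]

/-- Pythagoras for `S`, which is an isometry on the kernel of `C`. -/
theorem Matrix.mulVec_add_dotProduct_self_of_mem_ker {m n k : ℕ} {C : Matrix (Fin m) (Fin n) ℝ}
    {S : Matrix (Fin k) (Fin n) ℝ} (hCS : Cᵀ * C + Sᵀ * S = 1) {z w : Fin n → ℝ}
    (hw : C *ᵥ w = 0) (hzw : z ⬝ᵥ w = 0) :
    (S *ᵥ (z + w)) ⬝ᵥ (S *ᵥ (z + w)) = (S *ᵥ z) ⬝ᵥ (S *ᵥ z) + w ⬝ᵥ w := by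
  have hS : (Sᵀ * S) *ᵥ w = w := by
    have h := congrArg (· *ᵥ w) hCS
    simpa [add_mulVec, ← mulVec_mulVec Cᵀ, ← mulVec_mulVec w Cᵀ C, hw] using h
  have h1 : (S *ᵥ z) ⬝ᵥ (S *ᵥ w) = 0 := by rw [mulVec_dotProduct_mulVec, hS, hzw]
  have h2 : (S *ᵥ w) ⬝ᵥ (S *ᵥ w) = w ⬝ᵥ w := by rw [mulVec_dotProduct_mulVec, hS]
  rw [mulVec_add, add_dotProduct, dotProduct_add, dotProduct_add,
    dotProduct_comm (S *ᵥ w) (S *ᵥ z), h1, h2]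
  ring

/-- given a GSVD `A = U C X⁻¹`, `R = V S X⁻¹` of the pair `(A, R)` — with `U, V`
orthogonal, `X` invertible, `C, S` "diagonal" rectangular matrices with nonnegative diagonal
entries and `Cᵀ C + Sᵀ S = I` — and `C†` the pseudoinverse of `C`, for every `v` in the range of
`A` the vector `x₀ = X C† Uᵀ v` solves `A x₀ = v` and is the unique minimizer of `‖R x‖₂`
subject to `A x = v`. -/
theorem stmt10 {m n k : ℕ}
    (A : Matrix (Fin m) (Fin n) ℝ) (R : Matrix (Fin k) (Fin n) ℝ)
    (U : Matrix (Fin m) (Fin m) ℝ) (hU : Uᵀ * U = 1)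
    (V : Matrix (Fin k) (Fin k) ℝ) (hV : Vᵀ * V = 1)
    (X : Matrix (Fin n) (Fin n) ℝ) (hX : IsUnit X.det)
    (C : Matrix (Fin m) (Fin n) ℝ) (S : Matrix (Fin k) (Fin n) ℝ)
    (hCdiag : ∀ (i : Fin m) (j : Fin n), (i : ℕ) ≠ (j : ℕ) → C i j = 0)
    (hSdiag : ∀ (i : Fin k) (j : Fin n), (i : ℕ) ≠ (j : ℕ) → S i j = 0)
    (hCpos : ∀ (i : Fin m) (j : Fin n), (i : ℕ) = (j : ℕ) → 0 ≤ C i j)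
    (hSpos : ∀ (i : Fin k) (j : Fin n), (i : ℕ) = (j : ℕ) → 0 ≤ S i j)
    (hCS : Cᵀ * C + Sᵀ * S = 1)
    (hA : A = U * C * X⁻¹) (hR : R = V * S * X⁻¹)
    (v : Fin m → ℝ) (hv : v ∈ Set.range A.mulVec) :
    let Cdag : Matrix (Fin n) (Fin m) ℝ :=
      Matrix.of fun i j => if (i : ℕ) = (j : ℕ) ∧ C j i ≠ 0 then (C j i)⁻¹ else 0
    let x₀ : Fin n → ℝ := (X * Cdag * Uᵀ).mulVec v
    A.mulVec x₀ = v ∧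
    (∀ x : Fin n → ℝ, A.mulVec x = v →
      euclNorm (R.mulVec x₀) ≤ euclNorm (R.mulVec x)) ∧
    (∀ x : Fin n → ℝ,
      (A.mulVec x = v ∧ ∀ y : Fin n → ℝ, A.mulVec y = v →
        euclNorm (R.mulVec x) ≤ euclNorm (R.mulVec y)) → x = x₀) := by
  intro Cdag x₀
  have hXX : X⁻¹ * X = 1 := nonsing_inv_mul X hX
  have hXX' : X * X⁻¹ = 1 := mul_nonsing_inv X hX
  have hUU : U * Uᵀ = 1 := mul_eq_one_comm.mp hU
  have hAx : ∀ x, A *ᵥ x = U *ᵥ (C *ᵥ (X⁻¹ *ᵥ x)) := fun x => by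
    simp only [hA, mulVec_mulVec, Matrix.mul_assoc]
  have hRx : ∀ x, (R *ᵥ x) ⬝ᵥ (R *ᵥ x) = (S *ᵥ (X⁻¹ *ᵥ x)) ⬝ᵥ (S *ᵥ (X⁻¹ *ᵥ x)) := fun x => by
    rw [hR, ← mulVec_mulVec, ← mulVec_mulVec, mulVec_dotProduct_mulVec V, hV, one_mulVec]
  have hx₀ : X⁻¹ *ᵥ x₀ = C.rectDiagonalPinv *ᵥ (Uᵀ *ᵥ v) := by
    change X⁻¹ *ᵥ ((X * C.rectDiagonalPinv * Uᵀ) *ᵥ v) = _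
    rw [mulVec_mulVec, Matrix.mul_assoc X, ← Matrix.mul_assoc X⁻¹, hXX, Matrix.one_mul,
      mulVec_mulVec]
  have hCx : ∀ x, A *ᵥ x = v → C *ᵥ (X⁻¹ *ᵥ x) = Uᵀ *ᵥ v := fun x hx => by
    rw [← hx, hAx, mulVec_mulVec _ Uᵀ, hU, one_mulVec]
  have hCx₀ : C *ᵥ (X⁻¹ *ᵥ x₀) = Uᵀ *ᵥ v := by
    obtain ⟨y, hy⟩ := hv
    rw [hx₀, ← hCx y hy, mulVec_rectDiagonalPinv_mulVec_mulVec hCdiag]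
  have hAx₀ : A *ᵥ x₀ = v := by
    rw [hAx, hCx₀, mulVec_mulVec, hUU, one_mulVec]
  have pythagoras : ∀ x, A *ᵥ x = v → (R *ᵥ x) ⬝ᵥ (R *ᵥ x) =
      (R *ᵥ x₀) ⬝ᵥ (R *ᵥ x₀) + (X⁻¹ *ᵥ x - X⁻¹ *ᵥ x₀) ⬝ᵥ (X⁻¹ *ᵥ x - X⁻¹ *ᵥ x₀) := by
    intro x hx
    have hw : C *ᵥ (X⁻¹ *ᵥ x - X⁻¹ *ᵥ x₀) = 0 := by
      rw [mulVec_sub, hCx x hx, hCx₀, sub_self]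
    have hzw : (X⁻¹ *ᵥ x₀) ⬝ᵥ (X⁻¹ *ᵥ x - X⁻¹ *ᵥ x₀) = 0 := by
      nth_rewrite 1 [hx₀]
      exact rectDiagonalPinv_mulVec_dotProduct_eq_zero hCdiag _ hw
    have h := mulVec_add_dotProduct_self_of_mem_ker hCS hw hzw
    rwa [add_sub_cancel, ← hRx, ← hRx] at h
  have dotProduct_self_nonneg : ∀ {l : ℕ} (y : Fin l → ℝ), 0 ≤ y ⬝ᵥ y := fun y =>
    Finset.sum_nonneg fun i _ => mul_self_nonneg (y i)
  refine ⟨hAx₀, fun x hx => Real.sqrt_le_sqrt ?_, fun x ⟨hx, hmin⟩ => ?_⟩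
  · rw [pythagoras x hx]
    exact le_add_of_nonneg_right (dotProduct_self_nonneg _)
  · have hle := (Real.sqrt_le_sqrt_iff (dotProduct_self_nonneg _)).mp (hmin x₀ hAx₀)
    rw [pythagoras x hx] at hle
    have h0 := dotProduct_self_eq_zero.mp
      (le_antisymm (by linarith) (dotProduct_self_nonneg (X⁻¹ *ᵥ x - X⁻¹ *ᵥ x₀)))
    have h := congrArg (X *ᵥ ·) (sub_eq_zero.mp h0)
    simpa [mulVec_mulVec, hXX'] using h
end

section
/- Fix v ∈ ℝ^M, an N×N real symmetric positive definite matrix G_F, and differentiable functions f₁, …, f_N : ℝ → ℝ and b₁, b₂, b₃ : ℝ → ℝ. For q ∈ ℝ^M define the M×N matrix Λ(q) by Λ(q)_{mn} = f_n(q_m), the M×3 matrix B(q) by B(q)_{mk} = b_k(q_m), and G̃(q) := Λ(q) G_F⁻¹ Λ(q)ᵀ; on the set where G̃(q) and B(q)ᵀ G̃(q)⁻¹ B(q) are invertible, define L_F(q) := G̃(q)⁻¹ (I − B(q) (B(q)ᵀ G̃(q)⁻¹ B(q))⁻¹ B(q)ᵀ G̃(q)⁻¹) and N(q) := vᵀ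 L_F(q) v. Suppose q⁰ ∈ ℝ^M is a point where G̃(q⁰) and B(q⁰)ᵀ G̃(q⁰)⁻¹ B(q⁰) are invertible, and set p := L_F(q⁰) v and w := (B(q⁰)ᵀ G̃(q⁰)⁻¹ B(q⁰))⁻¹ B(q⁰)ᵀ G̃(q⁰)⁻¹ v, and let Λ'(q⁰) be the M×N matrix with entries f_n'(q⁰_m) and B'(q⁰) the M×3 matrix with entries b_k'(q⁰_m). Then for each j = 1, …, M, the partial derivative of N with respect to q_j at q⁰ exists and equals −2 p_j · ( Λ'(q⁰) G_F⁻¹ Λ(q⁰)ᵀ p + B'(q⁰) w )_j. -/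
open Matrix

noncomputable section

/-- The interpolation matrix `Λ(q)_{mn} = f_n(q_m)`. -/
def lamMat {M N : ℕ} (f : Fin N → ℝ → ℝ) (q : Fin M → ℝ) :
    Matrix (Fin M) (Fin N) ℝ :=
  Matrix.of fun m n => f n (q m)

/-- The kernel-evaluation matrix `B(q)_{mk} = b_k(q_m)`. -/
def kerMat {M : ℕ} (b : Fin 3 → ℝ → ℝ) (q : Fin M → ℝ) :
    Matrix (Fin M) (Fin 3) ℝ :=
  Matrix.of fun m k => b k (q m)

/-- `G̃(q) = Λ(q) G_F⁻¹ Λ(q)ᵀ`. -/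
def gTil {M N : ℕ} (f : Fin N → ℝ → ℝ) (GF : Matrix (Fin N) (Fin N) ℝ)
    (q : Fin M → ℝ) : Matrix (Fin M) (Fin M) ℝ :=
  lamMat f q * GF⁻¹ * (lamMat f q)ᵀ

/-- The metric matrix `L_F(q) = G̃(q)⁻¹ (I - B(q) (B(q)ᵀ G̃(q)⁻¹ B(q))⁻¹ B(q)ᵀ G̃(q)⁻¹)`. -/
def lF {M N : ℕ} (f : Fin N → ℝ → ℝ) (GF : Matrix (Fin N) (Fin N) ℝ)
    (b : Fin 3 → ℝ → ℝ) (q : Fin M → ℝ) : Matrix (Fin M) (Fin M) ℝ :=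
  (gTil f GF q)⁻¹ *
    (1 - kerMat b q * ((kerMat b q)ᵀ * (gTil f GF q)⁻¹ * kerMat b q)⁻¹ *
      (kerMat b q)ᵀ * (gTil f GF q)⁻¹)

/-- The discretized squared Weil–Petersson norm `N(q) = vᵀ L_F(q) v`. -/
def wpNormSq {M N : ℕ} (f : Fin N → ℝ → ℝ) (GF : Matrix (Fin N) (Fin N) ℝ)
    (b : Fin 3 → ℝ → ℝ) (v : Fin M → ℝ) (q : Fin M → ℝ) : ℝ :=
  v ⬝ᵥ (lF f GF b q).mulVec v

/-- A product of a function vanishing at `x` with derivative `g'` there and a function continuous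
at `x` is differentiable at `x`. -/
lemma HasDerivAt.sub_const_mul_continuousAt {g h : ℝ → ℝ} {g' x : ℝ} (hg : HasDerivAt g g' x)
    (hh : ContinuousAt h x) : HasDerivAt (fun t => (g t - g x) * h t) (g' * h x) x := by
  rw [hasDerivAt_iff_tendsto_slope] at hg ⊢
  refine (hg.mul (hh.tendsto.mono_left nhdsWithin_le_nhds)).congr fun t => ?_
  simp [slope_def_field]
  ring

lemma hasDerivAt_dotProduct_sub {ι : Type*} [Fintype ι] {g : ι → ℝ → ℝ} {h : ℝ → ι → ℝ}
    {g' : ι → ℝ} {x : ℝ} (hg : ∀ i, HasDerivAt (g i) (g' i) x) (hh : ContinuousAt h x) :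
    HasDerivAt (fun t => (fun i => g i t - g i x) ⬝ᵥ h t) (g' ⬝ᵥ h x) x := by
  simp only [dotProduct]
  exact HasDerivAt.fun_sum fun i _ =>
    (hg i).sub_const_mul_continuousAt ((continuous_apply i).continuousAt.comp hh)

lemma ContinuousAt.matrix_inv {X n : Type*} [TopologicalSpace X] [Fintype n] [DecidableEq n]
    {A : X → Matrix n n ℝ} {x : X} (hA : ContinuousAt A x) (h : IsUnit (A x).det) :
    ContinuousAt (fun y => (A y)⁻¹) x := by
  refine ContinuousAt.comp (continuousAt_matrix_inv _ ?_) hA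
  obtain ⟨u, hu⟩ := h
  exact hu ▸ NormedRing.inverse_continuousAt u

lemma ContinuousAt.matrix_mul {X l m n : Type*} [TopologicalSpace X] [Fintype m]
    {A : X → Matrix l m ℝ} {B : X → Matrix m n ℝ} {x : X}
    (hA : ContinuousAt A x) (hB : ContinuousAt B x) : ContinuousAt (fun y => A y * B y) x :=
  (continuous_fst.matrix_mul continuous_snd : Continuous
    fun P : Matrix l m ℝ × Matrix m n ℝ => P.1 * P.2).continuousAt.comp (hA.prodMk hB)

lemma ContinuousAt.matrix_mulVec_const {X m n : Type*} [TopologicalSpace X] [Fintype n]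
    {A : X → Matrix m n ℝ} {x : X} (hA : ContinuousAt A x) (v : n → ℝ) :
    ContinuousAt (fun y => A y *ᵥ v) x :=
  (continuous_id.matrix_mulVec continuous_const : Continuous
    fun P : Matrix m n ℝ => P *ᵥ v).continuousAt.comp hA

lemma ContinuousAt.matrix_mulVec {X m n : Type*} [TopologicalSpace X] [Fintype n]
    {A : X → Matrix m n ℝ} {v : X → n → ℝ} {x : X} (hA : ContinuousAt A x)
    (hv : ContinuousAt v x) : ContinuousAt (fun y => A y *ᵥ v y) x :=
  (continuous_fst.matrix_mulVec continuous_snd : Continuous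
    fun P : Matrix m n ℝ × (n → ℝ) => P.1 *ᵥ P.2).continuousAt.comp (hA.prodMk hv)

lemma continuous_lamMat {M N : ℕ} {f : Fin N → ℝ → ℝ} (hf : ∀ n, Continuous (f n)) :
    Continuous (lamMat f : (Fin M → ℝ) → _) :=
  continuous_matrix fun m n => (hf n).comp (continuous_apply m)

lemma continuous_kerMat {M : ℕ} {b : Fin 3 → ℝ → ℝ} (hb : ∀ k, Continuous (b k)) :
    Continuous (kerMat b : (Fin M → ℝ) → _) :=
  continuous_matrix fun m k => (hb k).comp (continuous_apply m)

lemma continuous_gTil {M N : ℕ} {f : Fin N → ℝ → ℝ} (hf : ∀ n, Continuous (f n))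
    (GF : Matrix (Fin N) (Fin N) ℝ) : Continuous (gTil f GF : (Fin M → ℝ) → _) :=
  ((continuous_lamMat hf).matrix_mul continuous_const).matrix_mul
    (continuous_lamMat hf).matrix_transpose

lemma vecMul_lamMat_update_sub {M N : ℕ} (f : Fin N → ℝ → ℝ) (q p : Fin M → ℝ) (j : Fin M)
    (t : ℝ) : p ᵥ* (lamMat f (Function.update q j t) - lamMat f q) =
      p j • fun n => f n t - f n (q j) := by
  ext n
  simp only [vecMul, dotProduct, lamMat, Matrix.sub_apply, of_apply, Pi.smul_apply, smul_eq_mul]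
  rw [Finset.sum_eq_single j]
  · simp
  · intro i _ hi
    simp [hi]
  · simp

lemma vecMul_kerMat_update_sub {M : ℕ} (b : Fin 3 → ℝ → ℝ) (q p : Fin M → ℝ) (j : Fin M)
    (t : ℝ) : p ᵥ* (kerMat b (Function.update q j t) - kerMat b q) =
      p j • fun n => b n t - b n (q j) :=
  vecMul_lamMat_update_sub b q p j t

section SaddlePoint

variable {m n k : Type*} [Fintype m] [Fintype n] [Fintype k]

lemma saddlePoint_solution [DecidableEq m] [DecidableEq k] {G : Matrix m m ℝ} {B : Matrix m k ℝ}
    (hG : IsUnit G.det) (hS : IsUnit (Bᵀ * G⁻¹ * B).det) (v : m → ℝ) :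
    G *ᵥ ((G⁻¹ * (1 - B * (Bᵀ * G⁻¹ * B)⁻¹ * Bᵀ * G⁻¹)) *ᵥ v) +
        B *ᵥ (((Bᵀ * G⁻¹ * B)⁻¹ * Bᵀ * G⁻¹) *ᵥ v) = v ∧
      ((G⁻¹ * (1 - B * (Bᵀ * G⁻¹ * B)⁻¹ * Bᵀ * G⁻¹)) *ᵥ v) ᵥ* B = 0 := by
  constructor
  · rw [mulVec_mulVec, mulVec_mulVec, ← add_mulVec, mul_nonsing_inv_cancel_left _ _ hG]
    simp [Matrix.mul_assoc]
  · rw [← mulVec_transpose, mulVec_mulVec]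
    have : Bᵀ * (G⁻¹ * (1 - B * (Bᵀ * G⁻¹ * B)⁻¹ * Bᵀ * G⁻¹)) = 0 := by
      calc _ = Bᵀ * G⁻¹ - (Bᵀ * G⁻¹ * B) * (Bᵀ * G⁻¹ * B)⁻¹ * (Bᵀ * G⁻¹) := by
            simp only [Matrix.mul_sub, Matrix.mul_assoc, Matrix.mul_one]
        _ = 0 := by rw [mul_nonsing_inv _ hS]; simp
    rw [this, zero_mulVec]

/-- The exact increment of `v ⬝ᵥ p` between two solutions of saddle point systems with the same
right-hand side `v`. -/
lemma saddlePoint_sub {L L₀ : Matrix m n ℝ} {A : Matrix n n ℝ} (hA : Aᵀ = A)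
    {B B₀ : Matrix m k ℝ} {v p p₀ : m → ℝ} {w w₀ : k → ℝ}
    (h : (L * A * Lᵀ) *ᵥ p + B *ᵥ w = v) (hB : p ᵥ* B = 0)
    (h₀ : (L₀ * A * L₀ᵀ) *ᵥ p₀ + B₀ *ᵥ w₀ = v) (hB₀ : p₀ ᵥ* B₀ = 0) :
    v ⬝ᵥ p - v ⬝ᵥ p₀ =
      -((p₀ ᵥ* (L - L₀)) ⬝ᵥ ((A * Lᵀ) *ᵥ p) + (p ᵥ* (L - L₀)) ⬝ᵥ ((A * L₀ᵀ) *ᵥ p₀) +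
        (p₀ ᵥ* (B - B₀)) ⬝ᵥ w + (p ᵥ* (B - B₀)) ⬝ᵥ w₀) := by
  have e₁ : v ⬝ᵥ p = (p ᵥ* L₀) ⬝ᵥ ((A * L₀ᵀ) *ᵥ p₀) + (p ᵥ* B₀) ⬝ᵥ w₀ := by
    rw [← h₀, dotProduct_comm, dotProduct_add, dotProduct_mulVec p B₀, Matrix.mul_assoc,
      ← mulVec_mulVec, dotProduct_mulVec]
  have e₂ : v ⬝ᵥ p₀ = (p₀ ᵥ* L) ⬝ᵥ ((A * Lᵀ) *ᵥ p) + (p₀ ᵥ* B) ⬝ᵥ w := by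
    rw [← h, dotProduct_comm, dotProduct_add, dotProduct_mulVec p₀ B, Matrix.mul_assoc,
      ← mulVec_mulVec, dotProduct_mulVec]
  have e₃ : (p₀ ᵥ* L₀) ⬝ᵥ ((A * Lᵀ) *ᵥ p) = (p ᵥ* L) ⬝ᵥ ((A * L₀ᵀ) *ᵥ p₀) := by
    rw [← mulVec_mulVec, ← mulVec_mulVec, mulVec_transpose, mulVec_transpose,
      dotProduct_mulVec, ← mulVec_transpose, hA, dotProduct_comm]
  simp only [vecMul_sub, sub_dotProduct, hB, hB₀, zero_dotProduct]
  linarith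

end SaddlePoint

/-- the partial derivative of the discretized squared WP norm
`N(q) = vᵀ L_F(q) v` with respect to the particle position `q_j`, at a point `q⁰` where
`G̃(q⁰)` and `B(q⁰)ᵀ G̃(q⁰)⁻¹ B(q⁰)` are invertible, equals
`-2 p_j (Λ'(q⁰) G_F⁻¹ Λ(q⁰)ᵀ p + B'(q⁰) w)_j`, where `p = L_F(q⁰) v` are the momenta and
`w = (B(q⁰)ᵀ G̃(q⁰)⁻¹ B(q⁰))⁻¹ B(q⁰)ᵀ G̃(q⁰)⁻¹ v` are the kernel coefficients. -/
theorem stmt11 {M N : ℕ} (v : Fin M → ℝ)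
    (GF : Matrix (Fin N) (Fin N) ℝ) (hGF : GF.PosDef)
    (f f' : Fin N → ℝ → ℝ) (hf : ∀ n x, HasDerivAt (f n) (f' n x) x)
    (b b' : Fin 3 → ℝ → ℝ) (hb : ∀ k x, HasDerivAt (b k) (b' k x) x)
    (q0 : Fin M → ℝ)
    (hGt : IsUnit (gTil f GF q0).det)
    (hBGB : IsUnit ((kerMat b q0)ᵀ * (gTil f GF q0)⁻¹ * kerMat b q0).det)
    (j : Fin M) :
    let p : Fin M → ℝ := (lF f GF b q0).mulVec v
    let w : Fin 3 → ℝ :=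
      (((kerMat b q0)ᵀ * (gTil f GF q0)⁻¹ * kerMat b q0)⁻¹ *
        (kerMat b q0)ᵀ * (gTil f GF q0)⁻¹).mulVec v
    HasDerivAt (fun t : ℝ => wpNormSq f GF b v (Function.update q0 j t))
      (-2 * p j *
        ((lamMat f' q0 * GF⁻¹ * (lamMat f q0)ᵀ).mulVec p + (kerMat b' q0).mulVec w) j)
      (q0 j) := by
  intro p w
  have hfc : ∀ n, Continuous (f n) := fun n =>
    continuous_iff_continuousAt.2 fun x => (hf n x).continuousAt
  have hbc : ∀ k, Continuous (b k) := fun k =>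
    continuous_iff_continuousAt.2 fun x => (hb k x).continuousAt
  have hA : (GF⁻¹)ᵀ = GF⁻¹ := by
    have h := hGF.isHermitian.eq
    rw [conjTranspose_eq_transpose_of_trivial] at h
    rw [transpose_nonsing_inv, h]
  set Q : ℝ → Fin M → ℝ := fun t => Function.update q0 j t with hQ
  have hQc : Continuous Q := continuous_const.update j continuous_id
  have hQ0 : Q (q0 j) = q0 := Function.update_eq_self j q0
  have hLc : Continuous fun t => lamMat f (Q t) := (continuous_lamMat hfc).comp hQc
  have hBc : Continuous fun t => kerMat b (Q t) := (continuous_kerMat hbc).comp hQc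
  have hGc : Continuous fun t => gTil f GF (Q t) := (continuous_gTil hfc GF).comp hQc
  have hGi : ContinuousAt (fun t => (gTil f GF (Q t))⁻¹) (q0 j) :=
    hGc.continuousAt.matrix_inv (by rwa [hQ0])
  have hSc : ContinuousAt
      (fun t => (kerMat b (Q t))ᵀ * (gTil f GF (Q t))⁻¹ * kerMat b (Q t)) (q0 j) :=
    (hBc.matrix_transpose.continuousAt.matrix_mul hGi).matrix_mul hBc.continuousAt
  have hSi := hSc.matrix_inv (by rwa [hQ0])
  set W : ℝ → Fin 3 → ℝ := fun t =>
    (((kerMat b (Q t))ᵀ * (gTil f GF (Q t))⁻¹ * kerMat b (Q t))⁻¹ *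
        (kerMat b (Q t))ᵀ * (gTil f GF (Q t))⁻¹) *ᵥ v with hW
  set P : ℝ → Fin M → ℝ := fun t => lF f GF b (Q t) *ᵥ v with hP
  have hW0 : W (q0 j) = w := by simp only [hW, hQ0, w]
  have hP0 : P (q0 j) = p := by simp only [hP, hQ0, p]
  have hWc : ContinuousAt W (q0 j) :=
    ((hSi.matrix_mul hBc.matrix_transpose.continuousAt).matrix_mul hGi).matrix_mulVec_const v
  have hPc : ContinuousAt P (q0 j) := by
    refine ContinuousAt.matrix_mulVec_const (hGi.matrix_mul (continuousAt_const.sub ?_)) v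
    exact ((hBc.continuousAt.matrix_mul hSi).matrix_mul
      hBc.matrix_transpose.continuousAt).matrix_mul hGi
  have hGu : ∀ᶠ t in nhds (q0 j), IsUnit (gTil f GF (Q t)).det := by
    simp only [isUnit_iff_ne_zero] at hGt ⊢
    exact hGc.matrix_det.continuousAt.eventually_ne (by rwa [hQ0])
  have hSu : ∀ᶠ t in nhds (q0 j),
      IsUnit ((kerMat b (Q t))ᵀ * (gTil f GF (Q t))⁻¹ * kerMat b (Q t)).det := by
    simp only [isUnit_iff_ne_zero] at hBGB ⊢
    exact (continuous_id.matrix_det.continuousAt.comp hSc).eventually_ne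
      (by simpa [hQ0] using hBGB)
  obtain ⟨h₀, hB₀⟩ := saddlePoint_solution hGt hBGB v
  have key : (fun t => wpNormSq f GF b v (Q t)) =ᶠ[nhds (q0 j)] fun t =>
      v ⬝ᵥ p - (p j * ((fun n => f n t - f n (q0 j)) ⬝ᵥ ((GF⁻¹ * (lamMat f (Q t))ᵀ) *ᵥ P t)) +
        P t j * ((fun n => f n t - f n (q0 j)) ⬝ᵥ ((GF⁻¹ * (lamMat f q0)ᵀ) *ᵥ p)) +
        p j * ((fun k => b k t - b k (q0 j)) ⬝ᵥ W t) +
        P t j * ((fun k => b k t - b k (q0 j)) ⬝ᵥ w)) := by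
    filter_upwards [hGu, hSu] with t hG hS
    obtain ⟨h, hB⟩ := saddlePoint_solution hG hS v
    have e := saddlePoint_sub hA h hB h₀ hB₀
    simp only [hQ, vecMul_lamMat_update_sub, vecMul_kerMat_update_sub, smul_dotProduct,
      smul_eq_mul] at e
    exact sub_eq_iff_eq_add'.1 e
  refine HasDerivAt.congr_of_eventuallyEq ?_ key
  have hPj : ContinuousAt (fun t => P t j) (q0 j) := (continuous_apply j).continuousAt.comp hPc
  have d₁ := (hasDerivAt_dotProduct_sub (fun n => hf n (q0 j))
    ((continuous_const.matrix_mul hLc.matrix_transpose).continuousAt.matrix_mulVec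
      (A := fun t => GF⁻¹ * (lamMat f (Q t))ᵀ) hPc)).const_mul (p j)
  have d₂ := hasDerivAt_dotProduct_sub (fun n => hf n (q0 j))
    (hPj.fun_smul (continuousAt_const (y := (GF⁻¹ * (lamMat f q0)ᵀ) *ᵥ p)))
  have d₃ := (hasDerivAt_dotProduct_sub (fun k => hb k (q0 j)) hWc).const_mul (p j)
  have d₄ := hasDerivAt_dotProduct_sub (fun k => hb k (q0 j))
    (hPj.fun_smul (continuousAt_const (y := w)))
  simp only [dotProduct_smul, smul_eq_mul] at d₂ d₄
  refine ((((d₁.add d₂).add d₃).add d₄).const_sub (v ⬝ᵥ p)).congr_deriv ?_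
  have r₁ : ((lamMat f' q0 * GF⁻¹ * (lamMat f q0)ᵀ) *ᵥ p) j =
      (fun n => f' n (q0 j)) ⬝ᵥ ((GF⁻¹ * (lamMat f q0)ᵀ) *ᵥ p) := by
    rw [Matrix.mul_assoc, ← mulVec_mulVec]
    rfl
  have r₂ : (kerMat b' q0 *ᵥ w) j = (fun k => b' k (q0 j)) ⬝ᵥ w := rfl
  rw [Pi.add_apply, r₁, r₂, hQ0, hP0, hW0]
  ring

end
end
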